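/- Let N ≥ 0, let c be a point of the Euclidean plane ℝ², let p₀, p₁, …, p_{N+1} be points of ℝ², and let l₀, …, l_N be real numbers such that for every j ∈ {0,…,N} one has ‖p_j − p_{j+1}‖ = l_j and the inner product ⟪p_j − p_{j+1}, p_{j+1} − c⟫ = 0. Then ‖p₀ − c‖ ≥ √(Σ_{j=0}^{N} l_j²), with equality if and only if p_{N+1} = c. -/

import Mathlib

open RealInnerProductSpace

theorem hav_pythagoras (n : ℕ) (f : Fin (n + 1) → ℝ) (g : Fin n → ℝ)
    (h : ∀ j : Fin n, f j.castSucc = g j + f j.succ) :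
    f 0 = ∑ j, g j + f (Fin.last n) := by
  induction n with
  | zero => simp
  | succ n ih =>
    have h1 := ih (fun i => f i.castSucc) (fun i => g i.castSucc)
      (fun j => by simpa using h j.castSucc)
    have h2 := h (Fin.last n)
    rw [Fin.sum_univ_castSucc]
    simp only [Fin.castSucc_zero, Fin.succ_last] at h1 h2
    simp only [Nat.succ_eq_add_one] at *
    linarith

/-- Minimal stable circle of an HAV: under the tangency conditions, the radius of the
circle traced by the truck's front axle satisfies `‖p 0 - c‖ ≥ √(Σ l j²)`, with equality
iff the last axle coincides with the instantaneous center of rotation `c`. -/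
theorem minimal_stable_circle_radius (N : ℕ) (c : EuclideanSpace ℝ (Fin 2))
    (p : Fin (N + 2) → EuclideanSpace ℝ (Fin 2)) (l : Fin (N + 1) → ℝ)
    (hlen : ∀ j : Fin (N + 1), ‖p j.castSucc - p j.succ‖ = l j)
    (horth : ∀ j : Fin (N + 1), ⟪p j.castSucc - p j.succ, p j.succ - c⟫ = 0) :
    ‖p 0 - c‖ ≥ Real.sqrt (∑ j : Fin (N + 1), (l j) ^ 2) ∧
      (‖p 0 - c‖ = Real.sqrt (∑ j : Fin (N + 1), (l j) ^ 2) ↔ p (Fin.last (N + 1)) = c) := by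
  have key := hav_pythagoras (N + 1) (fun i => ‖p i - c‖ ^ 2) (fun j => l j ^ 2) (by
    intro j
    have h1 : p j.castSucc - c = (p j.castSucc - p j.succ) + (p j.succ - c) := by abel
    have h2 := norm_add_sq_real (p j.castSucc - p j.succ) (p j.succ - c)
    rw [← h1, horth j, hlen j] at h2
    simpa using h2)
  have hS : 0 ≤ ∑ j : Fin (N + 1), (l j) ^ 2 := Finset.sum_nonneg fun j _ => sq_nonneg _
  refine ⟨?_, ?_⟩
  · apply Real.sqrt_le_iff.mpr
    exact ⟨norm_nonneg _, by rw [key]; nlinarith [sq_nonneg ‖p (Fin.last (N + 1)) - c‖]⟩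
  · rw [eq_comm, Real.sqrt_eq_iff_eq_sq hS (norm_nonneg _), key, ← sub_eq_zero (b := c),
      ← norm_eq_zero, ← sq_eq_zero_iff (a := ‖p (Fin.last (N + 1)) - c‖)]
    constructor <;> intro h <;> linarith
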